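/- arXiv:1203.1821 — 2 statements merged into one kernel-verified Lean document; each statement's English description precedes it below -/
import Mathlib

section
/- Under hypotheses (a)–(d) of the main theorem, the sequences defined by X₀ = 0, Y₀ = M, X_{n+1} = Q + (V*XₙV + W*XₙW) − (U*YₙU + B*YₙB), Y_{n+1} = Q + (V*YₙV + W*YₙW) − (U*XₙU + B*XₙB) both converge (in spectral norm) to the unique Hermitian positive definite solution X̂ of A*XB + B*XA = −Q, with error bound max{‖Xₙ − X̂‖, ‖Yₙ − X̂‖} ≤ (δⁿ/(1−δ)) · max{‖X₁ − X₀‖, ‖Y₁ − Y₀‖} for some δ ∈ (0,1). -/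
open Matrix Filter
open scoped ComplexOrder

/-- The spectral norm (operator norm) of a complex matrix. -/
noncomputable def specNorm {N : ℕ} (A : Matrix (Fin N) (Fin N) ℂ) : ℝ :=
  ‖(Matrix.toEuclideanCLM (𝕜 := ℂ) A : EuclideanSpace ℂ (Fin N) →L[ℂ] EuclideanSpace ℂ (Fin N))‖

/-- The trace norm (sum of singular values) of a complex matrix. -/
noncomputable def traceNorm {N : ℕ} (A : Matrix (Fin N) (Fin N) ℂ) : ℝ :=
  ∑ i, Real.sqrt ((Matrix.posSemidef_conjTranspose_mul_self A).1.eigenvalues i)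

section OrderUnit

variable {E : Type*} [CStarAlgebra E]

/-- The map `X ↦ K* X K + L* X L`. -/
noncomputable def krausPair (K L : E) : E →ₗ[ℂ] E :=
  LinearMap.mulLeftRight ℂ (star K, K) + LinearMap.mulLeftRight ℂ (star L, L)

lemma krausPair_apply (K L X : E) :
    krausPair K L X = star K * X * K + star L * X * L := rfl

lemma krausPair_star (K L X : E) : krausPair K L (star X) = star (krausPair K L X) := by
  simp [krausPair_apply, mul_assoc]

variable [PartialOrder E] [StarOrderedRing E]

lemma krausPair_mono (K L : E) {X Y : E} (h : X ≤ Y) : krausPair K L X ≤ krausPair K L Y :=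
  add_le_add (star_left_conjugate_le_conjugate h K) (star_left_conjugate_le_conjugate h L)

/-- A strictly positive element is an order unit. -/
lemma IsStrictlyPositive.exists_le_smul {P H : E} (hP : IsStrictlyPositive P)
    (hH : IsSelfAdjoint H) : ∃ t : ℝ, 0 < t ∧ H ≤ t • P := by
  rcases subsingleton_or_nontrivial E with _ | _
  · exact ⟨1, one_pos, (Subsingleton.elim _ _).le⟩
  obtain ⟨r, hr, hrP⟩ := (CFC.exists_pos_algebraMap_le_iff hP.isSelfAdjoint).2
    fun x hx => hP.spectrum_pos hx
  refine ⟨(‖H‖ + 1) / r, by positivity, hH.le_algebraMap_norm_self.trans ?_⟩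
  have h := smul_le_smul_of_nonneg_left hrP (show 0 ≤ (‖H‖ + 1) / r by positivity)
  refine le_trans ?_ h
  rw [Algebra.algebraMap_eq_smul_one, Algebra.algebraMap_eq_smul_one, smul_smul,
    div_mul_cancel₀ _ hr.ne']
  exact smul_le_smul_of_nonneg_right (by linarith) zero_le_one

/-- `X` lies in the order interval `[-s M, s M]`. -/
def OrderBounded (M : E) (s : ℝ) (X : E) : Prop := X ≤ s • M ∧ -X ≤ s • M

lemma IsStrictlyPositive.exists_orderBounded {M X : E} (hM : IsStrictlyPositive M)
    (hX : IsSelfAdjoint X) : ∃ t : ℝ, 0 < t ∧ OrderBounded M t X := by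
  obtain ⟨t, ht, h⟩ := hM.exists_le_smul hX
  obtain ⟨u, hu, h'⟩ := hM.exists_le_smul hX.neg
  exact ⟨t + u, by positivity,
    h.trans (smul_le_smul_of_nonneg_right (by linarith) hM.nonneg),
    h'.trans (smul_le_smul_of_nonneg_right (by linarith) hM.nonneg)⟩

lemma OrderBounded.mono {M X : E} (hM : 0 ≤ M) {s t : ℝ} (h : OrderBounded M s X)
    (hst : s ≤ t) :
    OrderBounded M t X :=
  ⟨h.1.trans (smul_le_smul_of_nonneg_right hst hM),
    h.2.trans (smul_le_smul_of_nonneg_right hst hM)⟩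

lemma OrderBounded.norm_le {M X : E} {s : ℝ} (hs : 0 ≤ s)
    (h : OrderBounded M s X) : ‖X‖ ≤ s * (3 * ‖M‖) := by
  have h0 : 0 ≤ X + s • M := by simpa [add_comm] using neg_le_iff_add_nonneg.1 h.2
  have h1 : X + s • M ≤ s • M + s • M := by gcongr; exact h.1
  have h2 := CStarAlgebra.norm_le_norm_of_nonneg_of_le h0 h1
  have h3 : ‖X‖ ≤ ‖X + s • M‖ + ‖s • M‖ := by simpa using norm_sub_le (X + s • M) (s • M)
  have h4 := norm_add_le (s • M) (s • M)
  have h5 : ‖s • M‖ = s * ‖M‖ := by rw [norm_smul, Real.norm_of_nonneg hs]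
  linarith

/-- If `Φ M + Ψ M < M`, the pair iteration contracts in the order-unit norm of `M`. -/
lemma exists_contraction {M : E} (U B V W : E)
    (hM : IsStrictlyPositive M)
    (hc : IsStrictlyPositive (M - krausPair V W M - krausPair U B M)) :
    ∃ δ : ℝ, 0 < δ ∧ δ < 1 ∧ ∀ (s : ℝ) (X Y : E), 0 ≤ s → OrderBounded M s X →
      OrderBounded M s Y → OrderBounded M (δ * s) (krausPair V W X - krausPair U B Y) := by
  obtain ⟨t, ht, h⟩ := hc.exists_le_smul hM.isSelfAdjoint
  have hδ : krausPair V W M + krausPair U B M ≤ (t / (t + 1)) • M := by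
    have h' : M ≤ (t + 1) • (M - krausPair V W M - krausPair U B M) :=
      h.trans (smul_le_smul_of_nonneg_right (by linarith) hc.nonneg)
    have h2 := smul_le_smul_of_nonneg_left h' (show 0 ≤ (t + 1)⁻¹ by positivity)
    rw [smul_smul, inv_mul_cancel₀ (by positivity), one_smul] at h2
    have h3 : (t / (t + 1)) • M = M - (t + 1)⁻¹ • M := by
      rw [show t / (t + 1) = 1 - (t + 1)⁻¹ by field_simp; ring, sub_smul, one_smul]
    rw [h3, le_sub_iff_add_le, ← le_sub_iff_add_le']
    rwa [← sub_sub]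
  refine ⟨t / (t + 1), by positivity, by rw [div_lt_one] <;> linarith, ?_⟩
  have key : ∀ (s : ℝ) (X Y : E), 0 ≤ s → X ≤ s • M → -Y ≤ s • M →
      krausPair V W X - krausPair U B Y ≤ (t / (t + 1) * s) • M := by
    intro s X Y hs hX hY
    have h1 := krausPair_mono V W hX
    have h2 := krausPair_mono U B hY
    rw [LinearMap.map_smul_of_tower] at h1 h2
    rw [map_neg] at h2
    calc _ ≤ s • krausPair V W M + s • krausPair U B M := by
          rw [sub_eq_add_neg]; exact add_le_add h1 h2
      _ = s • (krausPair V W M + krausPair U B M) := (smul_add _ _ _).symm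
      _ ≤ s • ((t / (t + 1)) • M) := smul_le_smul_of_nonneg_left hδ hs
      _ = _ := by rw [smul_smul, mul_comm]
  intro s X Y hs hX hY
  refine ⟨key s X Y hs hX.1 hY.2, ?_⟩
  have := key s (-X) (-Y) hs hX.2 (by simpa using hY.1)
  rw [map_neg, map_neg] at this
  convert this using 1
  abel

lemma eq_zero_of_fixed {M : E} (U B V W : E)
    (hM : IsStrictlyPositive M)
    (hc : IsStrictlyPositive (M - krausPair V W M - krausPair U B M))
    {X : E} (hX : X = krausPair V W X - krausPair U B X) : X = 0 := by
  obtain ⟨δ, h0, h1, hδ⟩ := exists_contraction U B V W hM hc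
  have sa : ∀ Z : E, IsSelfAdjoint Z → Z = krausPair V W Z - krausPair U B Z → Z = 0 := by
    intro Z hZ hfix
    obtain ⟨t, ht, hb⟩ := hM.exists_orderBounded hZ
    have hn : ∀ n : ℕ, OrderBounded M (δ ^ n * t) Z := by
      intro n
      induction n with
      | zero => simpa using hb
      | succ n ih =>
        have := hδ _ Z Z (by positivity) ih ih
        rwa [← hfix, ← mul_assoc, ← pow_succ'] at this
    have hlim : Tendsto (fun n : ℕ => δ ^ n * t * (3 * ‖M‖)) atTop (nhds 0) := by
      have := ((tendsto_pow_atTop_nhds_zero_of_lt_one h0.le h1).mul_const t).mul_const (3 * ‖M‖)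
      simpa using this
    have := ge_of_tendsto' hlim fun n => (hn n).norm_le (by positivity)
    exact norm_le_zero_iff.1 this
  have hXs : star X = krausPair V W (star X) - krausPair U B (star X) := by
    rw [krausPair_star, krausPair_star, ← star_sub, ← hX]
  have e1 : X + star X = 0 := by
    refine sa _ (by simp [isSelfAdjoint_iff, add_comm]) ?_
    rw [map_add, map_add, add_sub_add_comm, ← hX, ← hXs]
  have e2 : Complex.I • (X - star X) = 0 := by
    refine sa _ ?_ ?_
    · rw [isSelfAdjoint_iff, star_smul, star_sub, star_star, ← neg_sub X, smul_neg]
      simp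
    rw [map_smul, map_smul, map_sub, map_sub, ← smul_sub, sub_sub_sub_comm, ← hX, ← hXs]
  have e3 : X - star X = 0 := (smul_eq_zero.1 e2).resolve_left Complex.I_ne_zero
  have e4 : (2 : ℂ) • X = 0 := by
    rw [two_smul, show X + X = (X + star X) + (X - star X) by abel, e1, e3, add_zero]
  exact (smul_eq_zero.1 e4).resolve_left two_ne_zero

/-- The Stein-type equation `X = Q + Φ X - Ψ X` is uniquely solvable. -/
lemma exists_unique_fixed [FiniteDimensional ℂ E] {M Q : E} (U B V W : E)
    (hM : IsStrictlyPositive M) (hQ : IsSelfAdjoint Q)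
    (hc : IsStrictlyPositive (M - krausPair V W M - krausPair U B M)) :
    ∃ X : E, IsSelfAdjoint X ∧ X = Q + krausPair V W X - krausPair U B X ∧
      ∀ Z, Z = Q + krausPair V W Z - krausPair U B Z → Z = X := by
  have uniq : ∀ Y Z : E, Y = Q + krausPair V W Y - krausPair U B Y →
      Z = Q + krausPair V W Z - krausPair U B Z → Z = Y := by
    intro Y Z hY hZ
    refine sub_eq_zero.1 (eq_zero_of_fixed U B V W hM hc ?_)
    rw [map_sub, map_sub]
    nth_rw 1 [hY, hZ]
    abel
  let L : E →ₗ[ℂ] E := LinearMap.id - krausPair V W + krausPair U B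
  have hL : Function.Injective L := by
    rw [← LinearMap.ker_eq_bot, LinearMap.ker_eq_bot']
    intro X hX
    refine eq_zero_of_fixed U B V W hM hc ?_
    rw [← sub_eq_zero, ← hX]
    simp only [L, LinearMap.add_apply, LinearMap.sub_apply, LinearMap.id_apply]
    abel
  obtain ⟨X, hX⟩ := LinearMap.surjective_of_injective hL Q
  have hfix : X = Q + krausPair V W X - krausPair U B X := by
    rw [← hX]
    simp only [L, LinearMap.add_apply, LinearMap.sub_apply, LinearMap.id_apply]
    abel
  refine ⟨X, uniq _ _ hfix ?_, hfix, fun Z hZ => uniq _ _ hfix hZ⟩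
  rw [krausPair_star, krausPair_star]
  nth_rw 1 [hfix]
  rw [star_sub, star_add, hQ.star_eq]

/-- Geometric convergence of the coupled iteration, in norm. -/
lemma exists_norm_le_geometric {M Q Z : E} (U B V W : E)
    (hM : IsStrictlyPositive M)
    (hc : IsStrictlyPositive (M - krausPair V W M - krausPair U B M))
    (hZ : IsSelfAdjoint Z) (hfix : Z = Q + krausPair V W Z - krausPair U B Z)
    {X Y : ℕ → E} (hX0 : IsSelfAdjoint (X 0)) (hY0 : IsSelfAdjoint (Y 0))
    (hXs : ∀ n, X (n + 1) = Q + krausPair V W (X n) - krausPair U B (Y n))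
    (hYs : ∀ n, Y (n + 1) = Q + krausPair V W (Y n) - krausPair U B (X n)) :
    ∃ δ C : ℝ, 0 < δ ∧ δ < 1 ∧ 0 < C ∧
      ∀ n, ‖X n - Z‖ ≤ C * δ ^ n ∧ ‖Y n - Z‖ ≤ C * δ ^ n := by
  obtain ⟨δ, h0, h1, hδ⟩ := exists_contraction U B V W hM hc
  obtain ⟨t, ht, hbX⟩ := hM.exists_orderBounded (hX0.sub hZ)
  obtain ⟨u, hu, hbY⟩ := hM.exists_orderBounded (hY0.sub hZ)
  have hstep : ∀ S T : E, Q + krausPair V W S - krausPair U B T - Z =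
      krausPair V W (S - Z) - krausPair U B (T - Z) := by
    intro S T
    nth_rw 1 [hfix]
    rw [map_sub, map_sub]
    abel
  have hn : ∀ n : ℕ, OrderBounded M (δ ^ n * (t + u)) (X n - Z) ∧
      OrderBounded M (δ ^ n * (t + u)) (Y n - Z) := by
    intro n
    induction n with
    | zero => exact ⟨hbX.mono hM.nonneg (by simp [hu.le]), hbY.mono hM.nonneg (by simp [ht.le])⟩
    | succ n ih =>
      rw [hXs, hYs, hstep, hstep, pow_succ', mul_assoc]
      exact ⟨hδ _ _ _ (by positivity) ih.1 ih.2, hδ _ _ _ (by positivity) ih.2 ih.1⟩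
  have hC : ∀ n : ℕ, δ ^ n * (t + u) * (3 * ‖M‖) ≤ ((t + u) * (3 * ‖M‖) + 1) * δ ^ n := by
    intro n
    nlinarith [pow_pos h0 n]
  exact ⟨δ, (t + u) * (3 * ‖M‖) + 1, h0, h1, by positivity, fun n =>
    ⟨((hn n).1.norm_le (by positivity)).trans (hC n),
      ((hn n).2.norm_le (by positivity)).trans (hC n)⟩⟩

lemma iterates_mem_Icc {M Q : E} (U B V W : E) (hM : 0 ≤ M)
    (hd1 : krausPair U B M ≤ Q) (hd2 : Q ≤ M - krausPair V W M)
    {X Y : ℕ → E} (hX0 : X 0 = 0) (hY0 : Y 0 = M)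
    (hXs : ∀ n, X (n + 1) = Q + krausPair V W (X n) - krausPair U B (Y n))
    (hYs : ∀ n, Y (n + 1) = Q + krausPair V W (Y n) - krausPair U B (X n)) (n : ℕ) :
    X n ∈ Set.Icc 0 M ∧ Y n ∈ Set.Icc 0 M := by
  have step : ∀ S ∈ Set.Icc 0 M, ∀ T ∈ Set.Icc 0 M,
      Q + krausPair V W S - krausPair U B T ∈ Set.Icc 0 M := by
    intro S hS T hT
    have hVW0 : 0 ≤ krausPair V W S := by simpa using krausPair_mono V W hS.1
    have hUB0 : 0 ≤ krausPair U B T := by simpa using krausPair_mono U B hT.1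
    constructor
    · rw [sub_nonneg]
      exact ((krausPair_mono U B hT.2).trans hd1).trans (le_add_of_nonneg_right hVW0)
    · refine (sub_le_self _ hUB0).trans ?_
      rw [← le_sub_iff_add_le]
      exact hd2.trans (sub_le_sub_left (krausPair_mono V W hS.2) M)
  induction n with
  | zero => simp [hX0, hY0, hM]
  | succ n ih =>
    rw [hXs, hYs]
    exact ⟨step _ ih.1 _ ih.2, step _ ih.2 _ ih.1⟩

end OrderUnit

/-- A geometric rate can be slowed down so that `1 / (1 - δ)` absorbs the constant. -/
lemma exists_rate_absorbing_const {δ₀ C d : ℝ} (h0 : 0 < δ₀) (h1 : δ₀ < 1) (hC : 0 < C)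
    (hd : 0 < d) :
    ∃ δ : ℝ, 0 < δ ∧ δ < 1 ∧ ∀ n : ℕ, C * δ₀ ^ n ≤ δ ^ n / (1 - δ) * d := by
  have hpos : 0 < d / C := by positivity
  have hlt : max δ₀ (1 - d / C) < 1 := max_lt h1 (by linarith)
  have hge := le_max_right δ₀ (1 - d / C)
  have hle := le_max_left δ₀ (1 - d / C)
  set δ := max δ₀ (1 - d / C)
  refine ⟨δ, h0.trans_le hle, hlt, fun n => ?_⟩
  have hCd : C ≤ d / (1 - δ) := by
    rw [le_div_iff₀ (by linarith), ← le_div_iff₀' hC]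
    linarith
  calc C * δ₀ ^ n ≤ d / (1 - δ) * δ ^ n := by gcongr
    _ = _ := by ring

/-- Adding `X` to `A* X B + B* X A` gives a difference of two completely positive maps. -/
lemma sandwich_identity {N : ℕ} {A B U V W : Matrix (Fin N) (Fin N) ℂ}
    (hU : U = ((Real.sqrt 2 : ℂ))⁻¹ • (A - B + 1))
    (hV : V = ((Real.sqrt 2 : ℂ))⁻¹ • (A + B + 1))
    (hW : W = B - 1) (Z : Matrix (Fin N) (Fin N) ℂ) :
    (Vᴴ * Z * V + Wᴴ * Z * W) - (Uᴴ * Z * U + Bᴴ * Z * B) = Aᴴ * Z * B + Bᴴ * Z * A + Z := by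
  have hs : ((Real.sqrt 2 : ℂ))⁻¹ * ((Real.sqrt 2 : ℂ))⁻¹ = 1 / 2 := by
    rw [← mul_inv, ← Complex.ofReal_mul, Real.mul_self_sqrt (by norm_num)]
    norm_num
  have hc : star ((Real.sqrt 2 : ℂ))⁻¹ = ((Real.sqrt 2 : ℂ))⁻¹ := by simp
  have hsmul : ∀ T : Matrix (Fin N) (Fin N) ℂ,
      (((Real.sqrt 2 : ℂ))⁻¹ • T)ᴴ * Z * (((Real.sqrt 2 : ℂ))⁻¹ • T) =
        (1 / 2 : ℂ) • (Tᴴ * Z * T) := by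
    intro T
    rw [conjTranspose_smul, hc, smul_mul_assoc, smul_mul_assoc, mul_smul_comm, smul_smul, hs]
  rw [hU, hV, hW, hsmul, hsmul]
  have hdiff : (A + B + 1)ᴴ * Z * (A + B + 1) - (A - B + 1)ᴴ * Z * (A - B + 1) =
      (2 : ℂ) • (Aᴴ * Z * B + Bᴴ * Z * A + Z * B + Bᴴ * Z) := by
    simp only [conjTranspose_add, conjTranspose_sub, conjTranspose_one, two_smul]
    noncomm_ring
  rw [add_sub_add_comm, ← smul_sub, hdiff, smul_smul]
  simp only [conjTranspose_sub, conjTranspose_one]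
  norm_num
  noncomm_ring

open scoped MatrixOrder Matrix.Norms.L2Operator in
lemma exists_solution_and_rate {N : ℕ} {A B Q M U V W : Matrix (Fin N) (Fin N) ℂ}
    (hQ : Q.PosDef) (hM : M.PosDef)
    (hU : U = ((Real.sqrt 2 : ℂ))⁻¹ • (A - B + 1))
    (hV : V = ((Real.sqrt 2 : ℂ))⁻¹ • (A + B + 1))
    (hW : W = B - 1)
    (hc : ((M - (Vᴴ * M * V + Wᴴ * M * W)) - (Uᴴ * M * U + Bᴴ * M * B)).PosDef)
    (hd1 : (Q - (Uᴴ * M * U + Bᴴ * M * B)).PosDef)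
    (hd2 : ((M - (Vᴴ * M * V + Wᴴ * M * W)) - Q).PosDef)
    {X Y : ℕ → Matrix (Fin N) (Fin N) ℂ}
    (hX0 : X 0 = 0) (hY0 : Y 0 = M)
    (hXs : ∀ n, X (n + 1) =
      Q + (Vᴴ * X n * V + Wᴴ * X n * W) - (Uᴴ * Y n * U + Bᴴ * Y n * B))
    (hYs : ∀ n, Y (n + 1) =
      Q + (Vᴴ * Y n * V + Wᴴ * Y n * W) - (Uᴴ * X n * U + Bᴴ * X n * B)) :
    ∃ Z : Matrix (Fin N) (Fin N) ℂ,
      (Z.PosDef ∧ Aᴴ * Z * B + Bᴴ * Z * A = -Q) ∧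
      (∀ T, Aᴴ * T * B + Bᴴ * T * A = -Q → T = Z) ∧
      ∃ δ C : ℝ, 0 < δ ∧ δ < 1 ∧ 0 < C ∧
        ∀ n, specNorm (X n - Z) ≤ C * δ ^ n ∧ specNorm (Y n - Z) ≤ C * δ ^ n := by
  have fix_iff : ∀ T, T = Q + krausPair V W T - krausPair U B T ↔
      Aᴴ * T * B + Bᴴ * T * A = -Q := by
    intro T
    have h := sandwich_identity hU hV hW T
    rw [add_sub_assoc, krausPair_apply, krausPair_apply, star_eq_conjTranspose,
      star_eq_conjTranspose, star_eq_conjTranspose, star_eq_conjTranspose, h, ← add_assoc,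
      right_eq_add, add_comm, add_eq_zero_iff_eq_neg]
  have hMs := hM.isStrictlyPositive
  have hcs : IsStrictlyPositive (M - krausPair V W M - krausPair U B M) := hc.isStrictlyPositive
  obtain ⟨Z, hZsa, hZfix, hZuniq⟩ :=
    exists_unique_fixed U B V W hMs hQ.isStrictlyPositive.isSelfAdjoint hcs
  obtain ⟨δ, C, h0, h1, hC, hbound⟩ := exists_norm_le_geometric U B V W hMs hcs hZsa hZfix
    (by rw [hX0]; exact .zero _) (by rw [hY0]; exact hMs.isSelfAdjoint) hXs hYs
  have hmem := iterates_mem_Icc U B V W hMs.nonneg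
    (sub_nonneg.1 hd1.isStrictlyPositive.nonneg) (sub_nonneg.1 hd2.isStrictlyPositive.nonneg)
    hX0 hY0 hXs hYs
  have hlim : Tendsto X atTop (nhds Z) := by
    rw [tendsto_iff_norm_sub_tendsto_zero]
    refine squeeze_zero (fun n => norm_nonneg _) (fun n => (hbound n).1) ?_
    simpa using (tendsto_pow_atTop_nhds_zero_of_lt_one h0.le h1).const_mul C
  have hZ0 : 0 ≤ Z := ge_of_tendsto' hlim fun n => (hmem n).1.1
  have hZM : Z ≤ M := le_of_tendsto' hlim fun n => (hmem n).1.2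
  have hZpos : Z.PosDef := by
    have hrest : 0 ≤ krausPair V W Z + krausPair U B (M - Z) :=
      add_nonneg (by simpa using krausPair_mono V W hZ0)
        (by simpa using krausPair_mono U B (sub_nonneg.2 hZM))
    have hsum : Z = (Q - krausPair U B M) + (krausPair V W Z + krausPair U B (M - Z)) := by
      nth_rw 1 [hZfix]
      rw [map_sub]
      abel
    rw [hsum]
    exact PosDef.add_posSemidef hd1 (nonneg_iff_posSemidef.1 hrest)
  exact ⟨Z, ⟨hZpos, (fix_iff Z).1 hZfix⟩, fun T hT => hZuniq T ((fix_iff T).2 hT),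
    δ, C, h0, h1, hC, hbound⟩

theorem stmt9 {N : ℕ} (A B Q Qt M : Matrix (Fin N) (Fin N) ℂ)
    (hQ : Q.PosDef) (hQt : Qt.PosDef) (hM : M.PosDef)
    (U V W : Matrix (Fin N) (Fin N) ℂ)
    (hU : U = ((Real.sqrt 2 : ℂ))⁻¹ • (A - B + 1))
    (hV : V = ((Real.sqrt 2 : ℂ))⁻¹ • (A + B + 1))
    (hW : W = B - 1)
    (ha : (Qt - 2 • (U * Qt * Uᴴ + B * Qt * Bᴴ)).PosDef)
    (hb : (Qt - 2 • (V * Qt * Vᴴ + W * Qt * Wᴴ)).PosDef)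
    (hc : ((M - (Vᴴ * M * V + Wᴴ * M * W)) - (Uᴴ * M * U + Bᴴ * M * B)).PosDef)
    (hd1 : (Q - (Uᴴ * M * U + Bᴴ * M * B)).PosDef)
    (hd2 : ((M - (Vᴴ * M * V + Wᴴ * M * W)) - Q).PosDef)
    (X Y : ℕ → Matrix (Fin N) (Fin N) ℂ)
    (hX0 : X 0 = 0) (hY0 : Y 0 = M)
    (hXs : ∀ n, X (n + 1) =
      Q + (Vᴴ * X n * V + Wᴴ * X n * W) - (Uᴴ * Y n * U + Bᴴ * Y n * B))
    (hYs : ∀ n, Y (n + 1) =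
      Q + (Vᴴ * Y n * V + Wᴴ * Y n * W) - (Uᴴ * X n * U + Bᴴ * X n * B)) :
    ∃ Xh : Matrix (Fin N) (Fin N) ℂ,
      (Xh.PosDef ∧ Aᴴ * Xh * B + Bᴴ * Xh * A = -Q) ∧
      (∀ Z : Matrix (Fin N) (Fin N) ℂ,
        Z.PosDef → Aᴴ * Z * B + Bᴴ * Z * A = -Q → Z = Xh) ∧
      ∃ δ : ℝ, 0 < δ ∧ δ < 1 ∧
        Tendsto (fun n => specNorm (X n - Xh)) atTop (nhds 0) ∧
        Tendsto (fun n => specNorm (Y n - Xh)) atTop (nhds 0) ∧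
        ∀ n, max (specNorm (X n - Xh)) (specNorm (Y n - Xh)) ≤
          δ ^ n / (1 - δ) * max (specNorm (X 1 - X 0)) (specNorm (Y 1 - Y 0)) := by
  obtain ⟨Z, hZ, huniq, δ₀, C, h0, h1, hC, hbound⟩ :=
    exists_solution_and_rate hQ hM hU hV hW hc hd1 hd2 hX0 hY0 hXs hYs
  have hgeom : Tendsto (fun n : ℕ => C * δ₀ ^ n) atTop (nhds 0) := by
    simpa using (tendsto_pow_atTop_nhds_zero_of_lt_one h0.le h1).const_mul C
  have htX : Tendsto (fun n => specNorm (X n - Z)) atTop (nhds 0) :=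
    squeeze_zero (fun n => norm_nonneg _) (fun n => (hbound n).1) hgeom
  have htY : Tendsto (fun n => specNorm (Y n - Z)) atTop (nhds 0) :=
    squeeze_zero (fun n => norm_nonneg _) (fun n => (hbound n).2) hgeom
  refine ⟨Z, hZ, fun T _ hT => huniq T hT, ?_⟩
  rcases Nat.eq_zero_or_pos N with rfl | hN
  · refine ⟨1 / 2, by norm_num, by norm_num, htX, htY, fun n => ?_⟩
    have hzero : ∀ T : Matrix (Fin 0) (Fin 0) ℂ, specNorm T = 0 := fun T => by
      rw [Subsingleton.elim T 0, specNorm, map_zero, norm_zero]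
    simp [hzero]
  · have : NeZero N := ⟨hN.ne'⟩
    have hne : X 1 - X 0 ≠ 0 := by
      have h : X 1 - X 0 = Q - (Uᴴ * M * U + Bᴴ * M * B) := by
        rw [hXs 0, hX0, hY0]
        simp
      rw [h]
      exact hd1.isUnit.ne_zero
    have hpos : 0 < specNorm (X 1 - X 0) :=
      norm_pos_iff.2 ((map_ne_zero_iff _ (toEuclideanCLM (𝕜 := ℂ)).injective).2 hne)
    obtain ⟨δ, hδ0, hδ1, hδ⟩ := exists_rate_absorbing_const h0 h1 hC
      (lt_max_of_lt_left (b := specNorm (X 1 - X 0)) (c := specNorm (Y 1 - Y 0)) hpos)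
    exact ⟨δ, hδ0, hδ1, htX, htY, fun n =>
      (max_le (hbound n).1 (hbound n).2).trans (hδ n)⟩
end

section
/- Let A, B be N×N Hermitian matrices and Q Hermitian positive definite. If 2(U² + B²) < I, 2(V² + W²) < I, and U² + B² < Q < I − (V² + W²), where U = (A − B + I)/√2, V = (A + B + I)/√2, W = B − I, then the equation AXB + BXA = −Q has exactly one Hermitian positive definite solution X̂, and Q − (U² + B²) ≤ X̂ ≤ Q + (V² + W²). -/
open Matrix Filter
open scoped ComplexOrder

section CStarAlgebra

variable {E : Type*} [CStarAlgebra E] [PartialOrder E] [StarOrderedRing E]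

theorem IsSelfAdjoint.norm_le_of_le_algebraMap {a : E} {r : ℝ} (ha : IsSelfAdjoint a)
    (hr : 0 ≤ r) (h₁ : a ≤ algebraMap ℝ E r) (h₂ : -a ≤ algebraMap ℝ E r) : ‖a‖ ≤ r := by
  obtain _ | _ := subsingleton_or_nontrivial E
  · simpa [Subsingleton.elim a 0] using hr
  rcases CStarAlgebra.norm_or_neg_norm_mem_spectrum ha with h | h
  · exact (le_algebraMap_iff_spectrum_le ha).1 h₁ _ h
  · refine (le_algebraMap_iff_spectrum_le ha.neg).1 h₂ _ ?_
    rw [← spectrum.neg_eq]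
    simpa using h

theorem IsStrictlyPositive.norm_lt_one {a : E} (ha : 0 ≤ a) (h : IsStrictlyPositive (1 - a)) :
    ‖a‖ < 1 := by
  obtain _ | _ := subsingleton_or_nontrivial E
  · simp [Subsingleton.elim a 0]
  have hmem : 1 - ‖a‖ ∈ spectrum ℝ (1 - a) := by
    rw [← map_one (algebraMap ℝ E), ← spectrum.singleton_sub_eq]
    exact Set.sub_mem_sub rfl (CStarAlgebra.norm_mem_spectrum_of_nonneg ha)
  linarith [h.spectrum_pos hmem]

theorem PositiveLinearMap.norm_sub_apply_le (Φ Ψ : E →ₚ[ℂ] E) {a : E} (ha : IsSelfAdjoint a) :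
    ‖Ψ a - Φ a‖ ≤ ‖Φ 1 + Ψ 1‖ * ‖a‖ := by
  have hΦ : 0 ≤ Φ 1 := Φ.map_nonneg zero_le_one
  have hΨ : 0 ≤ Ψ 1 := Ψ.map_nonneg zero_le_one
  have map_norm (Θ : E →ₚ[ℂ] E) : Θ (algebraMap ℝ E ‖a‖) = ‖a‖ • Θ 1 := by
    rw [Algebra.algebraMap_eq_smul_one, ← Complex.coe_smul, map_smul, Complex.coe_smul]
  have bound : ‖a‖ • Φ 1 + ‖a‖ • Ψ 1 ≤ algebraMap ℝ E (‖Φ 1 + Ψ 1‖ * ‖a‖) := by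
    rw [mul_comm, ← smul_add, Algebra.algebraMap_eq_smul_one, mul_smul,
      ← Algebra.algebraMap_eq_smul_one]
    exact smul_le_smul_of_nonneg_left
      (IsSelfAdjoint.le_algebraMap_norm_self (.of_nonneg (add_nonneg hΦ hΨ))) (norm_nonneg a)
  have upper (Θ : E →ₚ[ℂ] E) : Θ a ≤ ‖a‖ • Θ 1 :=
    (Θ.apply_le_of_isSelfAdjoint a ha).trans_eq (map_norm Θ)
  have lower (Θ : E →ₚ[ℂ] E) : -Θ a ≤ ‖a‖ • Θ 1 := by
    simpa [map_norm] using Θ.apply_le_of_isSelfAdjoint (-a) ha.neg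
  refine ((ha.map Ψ).sub (ha.map Φ)).norm_le_of_le_algebraMap (by positivity)
    (le_trans ?_ bound) (le_trans ?_ bound)
  · rw [sub_eq_neg_add]
    exact add_le_add (lower Φ) (upper Ψ)
  · rw [neg_sub, sub_eq_add_neg]
    exact add_le_add (upper Φ) (lower Ψ)

theorem PositiveLinearMap.eq_of_isFixedPt_sub_add (Φ Ψ : E →ₚ[ℂ] E) (q : E)
    (h : ‖Φ 1 + Ψ 1‖ < 1) {x y : E} (hx : IsSelfAdjoint x) (hy : IsSelfAdjoint y)
    (hfx : x = q - Φ x + Ψ x) (hfy : y = q - Φ y + Ψ y) : x = y := by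
  have hle := norm_sub_apply_le Φ Ψ (hx.sub hy)
  have heq : Ψ (x - y) - Φ (x - y) = x - y := by
    rw [map_sub, map_sub]
    nth_rw 3 [hfx]
    nth_rw 3 [hfy]
    abel
  rw [heq] at hle
  rw [← sub_eq_zero, ← norm_le_zero_iff]
  nlinarith [norm_nonneg (x - y)]

theorem PositiveLinearMap.sub_add_mem_Icc (Φ Ψ : E →ₚ[ℂ] E) (q : E) {x : E}
    (hx : x ∈ Set.Icc 0 1) : q - Φ x + Ψ x ∈ Set.Icc (q - Φ 1) (q + Ψ 1) := by
  constructor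
  · exact le_add_of_le_of_nonneg (sub_le_sub_left (OrderHomClass.mono Φ hx.2) q)
      (Ψ.map_nonneg hx.1)
  · exact add_le_add (sub_le_self q (Φ.map_nonneg hx.1)) (OrderHomClass.mono Ψ hx.2)

theorem PositiveLinearMap.exists_fixedPt_sub_add (Φ Ψ : E →ₚ[ℂ] E) (q : E)
    (h : ‖Φ 1 + Ψ 1‖ < 1) (h₀ : Φ 1 ≤ q) (h₁ : q + Ψ 1 ≤ 1) :
    ∃ x ∈ Set.Icc (q - Φ 1) (q + Ψ 1), x = q - Φ x + Ψ x := by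
  obtain _ | _ := subsingleton_or_nontrivial E
  · exact ⟨q - Φ 1, ⟨le_rfl, (Subsingleton.elim _ _).le⟩, Subsingleton.elim _ _⟩
  have hmaps : Set.MapsTo (fun x ↦ q - Φ x + Ψ x) (Set.Icc 0 1) (Set.Icc 0 1) := fun x hx ↦
    have hx' := sub_add_mem_Icc Φ Ψ q hx
    ⟨(sub_nonneg.2 h₀).trans hx'.1, hx'.2.trans h₁⟩
  have hcontr : ContractingWith ‖Φ 1 + Ψ 1‖₊ (hmaps.restrict _ _ _) := by
    refine ⟨h, LipschitzWith.of_dist_le_mul fun x y ↦ ?_⟩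
    have hxy : IsSelfAdjoint ((x : E) - y) :=
      (IsSelfAdjoint.of_nonneg x.2.1).sub (.of_nonneg y.2.1)
    simp only [Subtype.dist_eq, dist_eq_norm, Set.MapsTo.val_restrict_apply, coe_nnnorm]
    convert! norm_sub_apply_le Φ Ψ hxy using 2
    simp only [map_sub]
    abel
  obtain ⟨x, hx, hfx, -⟩ := hcontr.exists_fixedPoint' isClosed_Icc.isComplete hmaps
    (Set.left_mem_Icc.2 zero_le_one) (edist_ne_top _ _)
  exact ⟨x, hfx.eq ▸ sub_add_mem_Icc Φ Ψ q hx, hfx.eq.symm⟩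

/-- The positive map `x ↦ a * x * a + b * x * b`, for self-adjoint `a` and `b`. -/
noncomputable def conjAdd (a b : E) (ha : IsSelfAdjoint a) (hb : IsSelfAdjoint b) : E →ₚ[ℂ] E :=
  PositiveLinearMap.mk₀
    (LinearMap.mulLeftRight ℂ (a, a) + LinearMap.mulLeftRight ℂ (b, b))
    fun _ hx ↦ by
      simpa using add_nonneg (ha.conjugate_nonneg hx) (hb.conjugate_nonneg hx)

theorem conjAdd_apply (a b x : E) (ha : IsSelfAdjoint a) (hb : IsSelfAdjoint b) :
    conjAdd a b ha hb x = a * x * a + b * x * b := rfl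

end CStarAlgebra

theorem mul_mul_add_mul_mul_eq_conj_sub_conj {R : Type*} [Ring R] [Algebra ℂ R] (A B X : R) :
    A * X * B + B * X * A =
      ((Real.sqrt 2 : ℂ)⁻¹ • (A + B + 1)) * X * ((Real.sqrt 2 : ℂ)⁻¹ • (A + B + 1)) +
        (B - 1) * X * (B - 1) -
      (((Real.sqrt 2 : ℂ)⁻¹ • (A - B + 1)) * X * ((Real.sqrt 2 : ℂ)⁻¹ • (A - B + 1)) +
        B * X * B) - X := by
  have h2 : (Real.sqrt 2 : ℂ)⁻¹ * (Real.sqrt 2 : ℂ)⁻¹ = 2⁻¹ := by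
    rw [← mul_inv, ← Complex.ofReal_mul, Real.mul_self_sqrt zero_le_two, Complex.ofReal_ofNat]
  simp only [smul_mul_assoc, mul_smul_comm, smul_smul, h2]
  simp only [add_mul, mul_add, sub_mul, mul_sub, one_mul, mul_one]
  module

open scoped MatrixOrder Matrix.Norms.L2Operator in
theorem stmt11 {N : ℕ} (A B Q : Matrix (Fin N) (Fin N) ℂ)
    (hA : A.IsHermitian) (hB : B.IsHermitian) (hQ : Q.PosDef)
    (U V W : Matrix (Fin N) (Fin N) ℂ)
    (hU : U = ((Real.sqrt 2 : ℂ))⁻¹ • (A - B + 1))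
    (hV : V = ((Real.sqrt 2 : ℂ))⁻¹ • (A + B + 1))
    (hW : W = B - 1)
    (hb : (1 - 2 • (U * U + B * B)).PosDef)
    (hc : (1 - 2 • (V * V + W * W)).PosDef)
    (hd1 : (Q - (U * U + B * B)).PosDef)
    (hd2 : ((1 - (V * V + W * W)) - Q).PosDef) :
    (∃! X : Matrix (Fin N) (Fin N) ℂ, X.PosDef ∧ A * X * B + B * X * A = -Q) ∧
    ∀ X : Matrix (Fin N) (Fin N) ℂ, X.PosDef → A * X * B + B * X * A = -Q →
      (X - (Q - (U * U + B * B))).PosSemidef ∧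
      ((Q + (V * V + W * W)) - X).PosSemidef := by
  have hsq : IsSelfAdjoint ((Real.sqrt 2 : ℂ)⁻¹) := by simp [isSelfAdjoint_iff]
  have hA' : IsSelfAdjoint A := hA
  have hB' : IsSelfAdjoint B := hB
  have hU' : IsSelfAdjoint U := hU ▸ hsq.smul ((hA'.sub hB').add (.one _))
  have hV' : IsSelfAdjoint V := hV ▸ hsq.smul ((hA'.add hB').add (.one _))
  have hW' : IsSelfAdjoint W := hW ▸ hB'.sub (.one _)
  let Φ := conjAdd U B hU' hB'
  let Ψ := conjAdd V W hV' hW'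
  have hΦ : Φ 1 = U * U + B * B := by simp [Φ, conjAdd_apply]
  have hΨ : Ψ 1 = V * V + W * W := by simp [Ψ, conjAdd_apply]
  have hnorm : ‖Φ 1 + Ψ 1‖ < 1 := by
    refine IsStrictlyPositive.norm_lt_one
      (add_nonneg (Φ.map_nonneg zero_le_one) (Ψ.map_nonneg zero_le_one)) ?_
    rw [Matrix.isStrictlyPositive_iff_posDef, hΦ, hΨ]
    convert! (hb.add hc).smul (show (0 : ℂ) < 2⁻¹ by simp) using 1
    module
  have heq (X : Matrix (Fin N) (Fin N) ℂ) :
      A * X * B + B * X * A = -Q ↔ X = Q - Φ X + Ψ X := by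
    rw [mul_mul_add_mul_mul_eq_conj_sub_conj, ← hU, ← hV, ← hW, conjAdd_apply,
      conjAdd_apply, ← sub_eq_zero, ← neg_eq_zero, ← sub_eq_zero (a := X)]
    refine Eq.congr ?_ rfl
    abel
  obtain ⟨X, hX, hfX⟩ := Φ.exists_fixedPt_sub_add Ψ Q hnorm
    (hΦ ▸ Matrix.le_iff.2 hd1.posSemidef) (by
      rw [hΨ, Matrix.le_iff, add_comm, ← sub_sub]
      exact hd2.posSemidef)
  have hXpos : X.PosDef := (hd1.isStrictlyPositive.of_le (hΦ ▸ hX.1)).posDef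
  have huniq (Y : Matrix (Fin N) (Fin N) ℂ) (hY : Y.PosDef)
      (hYeq : A * Y * B + B * Y * A = -Q) : Y = X :=
    Φ.eq_of_isFixedPt_sub_add Ψ Q hnorm hY.1 hXpos.1 ((heq Y).1 hYeq) hfX
  refine ⟨⟨X, ⟨hXpos, (heq X).2 hfX⟩, fun Y hY ↦ huniq Y hY.1 hY.2⟩, fun Y hY hYeq ↦ ?_⟩
  rw [huniq Y hY hYeq, ← hΦ, ← hΨ]
  exact hX
end
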